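/- Let Q : ℝⁿ → [0,∞) be a C¹ function, σ > 0 and r > 0, and define V : C⁰([−r,0];ℝⁿ) → [0,∞) by V(x) := max_{θ∈[−r,0]} e^{2σθ}·Q(x(θ)). Then V is Lipschitz on bounded sets of C⁰([−r,0];ℝⁿ): for every bounded set S ⊂ C⁰([−r,0];ℝⁿ), sup{ |V(x) − V(y)| / ‖x−y‖_r : x, y ∈ S, x ≠ y } < +∞. -/

import Mathlib

open Filter Topology MeasureTheory Set RealInnerProductSpace

noncomputable section

/-- ℝⁿ with the Euclidean norm. -/
abbrev Euc (n : ℕ) := EuclideanSpace ℝ (Fin n)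

/-- The state space C⁰([−r,0];ℝⁿ) with the sup norm. -/
abbrev Hist (n : ℕ) (r : ℝ) := C(Icc (-r) (0:ℝ), Euc n)

/-- Class K∞ functions (on [0,∞)). -/
def IsKinf (a : ℝ → ℝ) : Prop :=
  ContinuousOn a (Ici 0) ∧ StrictMonoOn a (Ici 0) ∧ a 0 = 0 ∧ Tendsto a atTop atTop

/-- Class K⁺: positive continuous functions on [0,∞). -/
def IsKplus (b : ℝ → ℝ) : Prop := ContinuousOn b (Ici 0) ∧ ∀ t, 0 ≤ t → 0 < b t

/-- Class ℰ: continuous nonnegative integrable functions on [0,∞) tending to 0. -/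
def IsClassE (q : ℝ → ℝ) : Prop :=
  ContinuousOn q (Ici 0) ∧ (∀ t, 0 ≤ t → 0 ≤ q t) ∧
    IntegrableOn q (Ici 0) ∧ Tendsto q atTop (𝓝 0)

/-- Continuous positive definite functions on [0,∞). -/
def IsPosDef (ρ : ℝ → ℝ) : Prop :=
  ContinuousOn ρ (Ici 0) ∧ ρ 0 = 0 ∧ (∀ s, 0 < s → 0 < ρ s) ∧ ∀ s, 0 ≤ s → 0 ≤ ρ s

/-- Membership in M_D : measurable selections of values in D. -/
def InMD {l : ℕ} (D : Set (Euc l)) (d : ℝ → Euc l) : Prop :=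
  Measurable d ∧ ∀ t, d t ∈ D

/-- The operator E_h(x;v) of Section 4.II: E_h(x;v)(θ) = x(0)+(θ+h)v for −h < θ ≤ 0 and
E_h(x;v)(θ) = x(θ+h) for −r ≤ θ ≤ −h. -/
def Ehist {n : ℕ} {r : ℝ} (h : ℝ) (x : Hist n r) (v : Euc n) : Hist n r :=
  if hr : -r ≤ 0 then
    { toFun := fun θ => if (θ : ℝ) ≤ -h then x (projIcc (-r) 0 hr ((θ : ℝ) + h))
        else x (projIcc (-r) 0 hr 0) + ((θ : ℝ) + h) • v
      continuous_toFun := by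
        apply Continuous.if_le
        · exact x.continuous.comp (continuous_projIcc.comp (by fun_prop))
        · exact continuous_const.add ((continuous_subtype_val.add continuous_const).smul
            continuous_const)
        · exact continuous_subtype_val
        · exact continuous_const
        · intro θ hθ
          rw [hθ]
          simp }
  else x

/-- The Dini derivative V⁰(t,x;v) of a functional V : [0,∞)×C⁰([−r,0];ℝⁿ) → ℝ:
V⁰(t,x;v) := limsup_{h→0⁺, y→0} (V(t+h, E_h(x;v)+h·y) − V(t,x))/h. -/
def diniH {n : ℕ} {r : ℝ} (V : ℝ → Hist n r → ℝ) (t : ℝ) (x : Hist n r) (v : Euc n) :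
    EReal :=
  Filter.limsup
    (fun p : ℝ × Hist n r =>
      (((V (t + p.1) (Ehist p.1 x v + p.1 • p.2) - V t x) / p.1 : ℝ) : EReal))
    ((𝓝[>] (0:ℝ)) ×ˢ 𝓝 0)

/-- The simplified Dini derivative V⁰(x;v) := limsup_{h→0⁺} (V(E_h(x;v)) − V(x))/h of a
time-independent functional. -/
def diniH0 {n : ℕ} {r : ℝ} (V : Hist n r → ℝ) (x : Hist n r) (v : Euc n) : EReal :=
  Filter.limsup (fun h : ℝ => (((V (Ehist h x v) - V x) / h : ℝ) : EReal)) (𝓝[>] (0:ℝ))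

/-- x : [t₀−r, tmax) → ℝⁿ (with history map φ) is a solution of the RFDE
ẋ(t) = F(t,d(t),T_r(t)x) with initial condition T_r(t₀)x = x₀, in integral form. -/
def IsSolutionRFDE {n l : ℕ} {r : ℝ} (F : ℝ → Euc l → Hist n r → Euc n)
    (d : ℝ → Euc l) (t₀ : ℝ) (x₀ : Hist n r) (tmax : EReal) (x : ℝ → Euc n)
    (φ : ℝ → Hist n r) : Prop :=
  (t₀ : EReal) < tmax ∧
  φ t₀ = x₀ ∧
  (∀ t : ℝ, t₀ ≤ t → (t : EReal) < tmax → ∀ θ : Icc (-r) (0:ℝ), φ t θ = x (t + θ)) ∧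
  ContinuousOn x {s : ℝ | t₀ - r ≤ s ∧ (s : EReal) < tmax} ∧
  (∀ t : ℝ, t₀ ≤ t → (t : EReal) < tmax → x t = x t₀ + ∫ s in t₀..t, F s (d s) (φ s))

/-- A functional V : [0,∞)×C⁰([−r,0];ℝⁿ) → [0,∞) which is
"almost Lipschitz on bounded sets" (Definition 4.5). -/
def AlmostLipschitzOn {n : ℕ} (r : ℝ) (V : ℝ → Hist n r → ℝ) : Prop :=
  ContinuousOn (fun p : ℝ × Hist n r => V p.1 p.2) (Ici 0 ×ˢ univ) ∧
  ∃ LV P G : ℝ → ℝ, Monotone LV ∧ Monotone P ∧ Monotone G ∧ (∀ s, 1 ≤ G s) ∧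
    (∀ R, 0 ≤ R → ∀ t ∈ Icc (0:ℝ) R, ∀ x y : Hist n r, ‖x‖ ≤ R → ‖y‖ ≤ R →
      |V t y - V t x| ≤ LV R * ‖y - x‖) ∧
    (∀ R, 0 ≤ R → ∀ M : ℝ, 0 ≤ M → ∀ x : Hist n r, ‖x‖ ≤ R →
      LipschitzWith (Real.toNNReal M) (fun θ : Icc (-r) (0:ℝ) => x θ) →
      ∀ t ∈ Icc (0:ℝ) R, ∀ h : ℝ, 0 ≤ h → h ≤ 1 / G (R + M) →
        |V (t + h) x - V t x| ≤ h * P R * (1 + M))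

/-- RGAOS (Definition 4.2) of the system ẋ(t) = F(t,d(t),T_r(t)x), Y(t) = H(t,T_r(t)x),
phrased via the existence of a family of unique maximal solutions satisfying robust
forward completeness and properties P1, P2. -/
def RGAOSrfde {n l : ℕ} {Y : Type*} [NormedAddCommGroup Y] [NormedSpace ℝ Y] (r : ℝ)
    (D : Set (Euc l)) (F : ℝ → Euc l → Hist n r → Euc n) (H : ℝ → Hist n r → Y) : Prop :=
  ∃ (X : ℝ → Hist n r → (ℝ → Euc l) → ℝ → Euc n)
    (Φ : ℝ → Hist n r → (ℝ → Euc l) → ℝ → Hist n r)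
    (tmax : ℝ → Hist n r → (ℝ → Euc l) → EReal),
    (∀ t₀ : ℝ, 0 ≤ t₀ → ∀ x₀ d, InMD D d →
      IsSolutionRFDE F d t₀ x₀ (tmax t₀ x₀ d) (X t₀ x₀ d) (Φ t₀ x₀ d) ∧
      ∀ tm y ψ, IsSolutionRFDE F d t₀ x₀ tm y ψ → tm ≤ tmax t₀ x₀ d ∧
        ∀ t : ℝ, t₀ ≤ t → (t : EReal) < tm → ψ t = Φ t₀ x₀ d t) ∧
    -- robust forward completeness
    (∀ T, 0 ≤ T → ∀ s, 0 ≤ s → ∃ M, ∀ t₀ ∈ Icc (0:ℝ) T, ∀ ξ ∈ Icc (0:ℝ) T,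
      ∀ x₀ : Hist n r, ‖x₀‖ ≤ s → ∀ d, InMD D d →
        ((t₀ + ξ : ℝ) : EReal) < tmax t₀ x₀ d ∧ ‖Φ t₀ x₀ d (t₀ + ξ)‖ ≤ M) ∧
    -- P1 (output stability)
    (∀ ε, 0 < ε → ∀ T, 0 ≤ T →
      (∃ M, ∀ t₀ ∈ Icc (0:ℝ) T, ∀ x₀ : Hist n r, ‖x₀‖ ≤ ε → ∀ d, InMD D d →
        ∀ t : ℝ, t₀ ≤ t → (t : EReal) < tmax t₀ x₀ d → ‖H t (Φ t₀ x₀ d t)‖ ≤ M) ∧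
      (∃ δ, 0 < δ ∧ ∀ t₀ ∈ Icc (0:ℝ) T, ∀ x₀ : Hist n r, ‖x₀‖ ≤ δ → ∀ d, InMD D d →
        ∀ t : ℝ, t₀ ≤ t → (t : EReal) < tmax t₀ x₀ d → ‖H t (Φ t₀ x₀ d t)‖ ≤ ε)) ∧
    -- P2 (uniform output attractivity on bounded sets of initial data)
    (∀ ε, 0 < ε → ∀ T, 0 ≤ T → ∀ R, 0 ≤ R → ∃ τ, 0 ≤ τ ∧
      ∀ t₀ ∈ Icc (0:ℝ) T, ∀ x₀ : Hist n r, ‖x₀‖ ≤ R → ∀ d, InMD D d →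
        ∀ t : ℝ, t₀ + τ ≤ t → (t : EReal) < tmax t₀ x₀ d → ‖H t (Φ t₀ x₀ d t)‖ ≤ ε)

/-- URGAOS (Definition 4.3) of the system ẋ(t) = F(t,d(t),T_r(t)x), Y(t) = H(t,T_r(t)x). -/
def URGAOSrfde {n l : ℕ} {Y : Type*} [NormedAddCommGroup Y] [NormedSpace ℝ Y] (r : ℝ)
    (D : Set (Euc l)) (F : ℝ → Euc l → Hist n r → Euc n) (H : ℝ → Hist n r → Y) : Prop :=
  ∃ (X : ℝ → Hist n r → (ℝ → Euc l) → ℝ → Euc n)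
    (Φ : ℝ → Hist n r → (ℝ → Euc l) → ℝ → Hist n r)
    (tmax : ℝ → Hist n r → (ℝ → Euc l) → EReal),
    (∀ t₀ : ℝ, 0 ≤ t₀ → ∀ x₀ d, InMD D d →
      IsSolutionRFDE F d t₀ x₀ (tmax t₀ x₀ d) (X t₀ x₀ d) (Φ t₀ x₀ d) ∧
      ∀ tm y ψ, IsSolutionRFDE F d t₀ x₀ tm y ψ → tm ≤ tmax t₀ x₀ d ∧
        ∀ t : ℝ, t₀ ≤ t → (t : EReal) < tm → ψ t = Φ t₀ x₀ d t) ∧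
    (∀ T, 0 ≤ T → ∀ s, 0 ≤ s → ∃ M, ∀ t₀ ∈ Icc (0:ℝ) T, ∀ ξ ∈ Icc (0:ℝ) T,
      ∀ x₀ : Hist n r, ‖x₀‖ ≤ s → ∀ d, InMD D d →
        ((t₀ + ξ : ℝ) : EReal) < tmax t₀ x₀ d ∧ ‖Φ t₀ x₀ d (t₀ + ξ)‖ ≤ M) ∧
    (∀ ε, 0 < ε →
      (∃ M, ∀ t₀ : ℝ, 0 ≤ t₀ → ∀ x₀ : Hist n r, ‖x₀‖ ≤ ε → ∀ d, InMD D d →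
        ∀ t : ℝ, t₀ ≤ t → (t : EReal) < tmax t₀ x₀ d → ‖H t (Φ t₀ x₀ d t)‖ ≤ M) ∧
      (∃ δ, 0 < δ ∧ ∀ t₀ : ℝ, 0 ≤ t₀ → ∀ x₀ : Hist n r, ‖x₀‖ ≤ δ → ∀ d, InMD D d →
        ∀ t : ℝ, t₀ ≤ t → (t : EReal) < tmax t₀ x₀ d → ‖H t (Φ t₀ x₀ d t)‖ ≤ ε)) ∧
    (∀ ε, 0 < ε → ∀ R, 0 ≤ R → ∃ τ, 0 ≤ τ ∧
      ∀ t₀ : ℝ, 0 ≤ t₀ → ∀ x₀ : Hist n r, ‖x₀‖ ≤ R → ∀ d, InMD D d →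
        ∀ t : ℝ, t₀ + τ ≤ t → (t : EReal) < tmax t₀ x₀ d → ‖H t (Φ t₀ x₀ d t)‖ ≤ ε)

/-- The functional V(x) := max_{θ∈[−r,0]} e^{2σθ}·Q(x(θ)) of Lemma 5.3. -/
def Vmax {n : ℕ} (r σ : ℝ) (Q : Euc n → ℝ) (x : Hist n r) : ℝ :=
  ⨆ θ : Icc (-r) (0:ℝ), Real.exp (2 * σ * (θ : ℝ)) * Q (x θ)

/-- Lemma 5.3, first assertion: V(x) = max_{θ∈[−r,0]} e^{2σθ}Q(x(θ)) is Lipschitz on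
bounded sets of C⁰([−r,0];ℝⁿ). -/
theorem stmt16 {n : ℕ} (r σ : ℝ) (hr : 0 < r) (hσ : 0 < σ)
    (Q : Euc n → ℝ) (hQ : ContDiff ℝ 1 Q) (hQpos : ∀ y, 0 ≤ Q y) :
    ∀ S : Set (Hist n r), Bornology.IsBounded S →
      ∃ L, ∀ x ∈ S, ∀ y ∈ S, |Vmax r σ Q x - Vmax r σ Q y| ≤ L * ‖x - y‖ := by
  intro S hS
  obtain ⟨R, hR⟩ := hS.exists_norm_le
  obtain ⟨C, hC⟩ := (isCompact_closedBall (0 : Euc n) R).exists_bound_of_continuousOn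
    (hQ.continuous_fderiv one_ne_zero).continuousOn
  have hne : Nonempty (Icc (-r) (0:ℝ)) := ⟨⟨0, by constructor <;> linarith⟩⟩
  have key : ∀ x ∈ S, ∀ y ∈ S, Vmax r σ Q x ≤ Vmax r σ Q y + C * ‖x - y‖ := by
    intro x hx y hy
    have hbdd : BddAbove (range fun θ : Icc (-r) (0:ℝ) =>
        Real.exp (2 * σ * (θ : ℝ)) * Q (y θ)) := by
      apply IsCompact.bddAbove
      apply isCompact_range
      have := hQ.continuous
      fun_prop
    refine ciSup_le fun θ => ?_
    have hxθ : x θ ∈ Metric.closedBall (0 : Euc n) R := by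
      simpa using (x.norm_coe_le_norm θ).trans (hR x hx)
    have hyθ : y θ ∈ Metric.closedBall (0 : Euc n) R := by
      simpa using (y.norm_coe_le_norm θ).trans (hR y hy)
    have hC0 : 0 ≤ C := (norm_nonneg _).trans (hC _ hxθ)
    have h1 : ‖Q (x θ) - Q (y θ)‖ ≤ C * ‖x θ - y θ‖ :=
      (convex_closedBall (0 : Euc n) R).norm_image_sub_le_of_norm_fderiv_le
        (fun z _ => (hQ.differentiable one_ne_zero) z) hC hyθ hxθ
    have h2 : ‖x θ - y θ‖ ≤ ‖x - y‖ := (x - y).norm_coe_le_norm θ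
    have h3 : Q (x θ) - Q (y θ) ≤ C * ‖x - y‖ :=
      (le_abs_self _).trans (h1.trans (mul_le_mul_of_nonneg_left h2 hC0))
    have h4 : Real.exp (2 * σ * (θ : ℝ)) * Q (y θ) ≤ Vmax r σ Q y := le_ciSup hbdd θ
    have h5 : Real.exp (2 * σ * (θ : ℝ)) ≤ 1 := by
      apply Real.exp_le_one_iff.mpr
      exact mul_nonpos_of_nonneg_of_nonpos (by positivity) θ.2.2
    have h6 := Real.exp_pos (2 * σ * (θ : ℝ))
    have h7 : 0 ≤ C * ‖x - y‖ := by positivity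
    have h8 := mul_le_mul_of_nonneg_left h3 h6.le
    have h9 := mul_le_mul_of_nonneg_right h5 h7
    linarith
  refine ⟨C, fun x hx y hy => abs_le.mpr ⟨?_, ?_⟩⟩
  · have := key y hy x hx
    rw [norm_sub_rev] at this
    linarith
  · have := key x hx y hy
    linarith
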